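/- arXiv:1112.5864 — 4 statements merged into one kernel-verified Lean document; each statement's English description precedes it below -/
import Mathlib

section
/- For every linear subspace U of V, the double orthogonal complement satisfies (U^⊥)^⊥ = U + rad V. -/
/-- The orthogonal complement of a set `S` with respect to a bilinear form `g`:
`S^⊥ = {v ∈ V | g(s,v) = 0 for all s ∈ S}`. -/
def setOrthogonal {V : Type*} [AddCommGroup V] [Module ℝ V]
    (g : V →ₗ[ℝ] V →ₗ[ℝ] ℝ) (S : Set V) : Submodule ℝ V where
  carrier := {v : V | ∀ s ∈ S, g s v = 0}
  add_mem' := by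
    intro a b ha hb s hs
    simp [map_add, ha s hs, hb s hs]
  zero_mem' := by
    intro s hs
    simp
  smul_mem' := by
    intro c a ha s hs
    simp [map_smul, ha s hs]


theorem orth_orth_eq_sup_radical {V : Type*} [AddCommGroup V] [Module ℝ V]
    [FiniteDimensional ℝ V] (g : V →ₗ[ℝ] V →ₗ[ℝ] ℝ)
    (hsymm : ∀ u v : V, g u v = g v u) (U : Submodule ℝ V) :
    setOrthogonal g ((setOrthogonal g (U : Set V) : Submodule ℝ V) : Set V) =
      U ⊔ setOrthogonal g (Set.univ : Set V) := by
  apply le_antisymm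
  · intro v hv
    have hann : g v ∈ (U.map g).dualCoannihilator.dualAnnihilator := by
      rw [Submodule.mem_dualAnnihilator]
      intro w hw
      rw [hsymm]
      refine hv w fun u hu => ?_
      exact (Submodule.mem_dualCoannihilator w).1 hw (g u) (Submodule.mem_map_of_mem hu)
    rw [Subspace.dualCoannihilator_dualAnnihilator_eq] at hann
    obtain ⟨u, hu, huv⟩ := hann
    refine Submodule.mem_sup.2 ⟨u, hu, v - u, fun s _ => ?_, add_sub_cancel u v⟩
    rw [hsymm, map_sub, huv, sub_self, LinearMap.zero_apply]
  · refine sup_le (fun u hu w hw => ?_) fun v hv w _ => hv w (Set.mem_univ w)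
    rw [hsymm]
    exact hw u hu
end

section
/- Let C ⊆ V* be a subspace such that V* = annih V ⊕ C (i.e., annih V ∩ C = {0} and annih V + C = V*). Then there exists a unique symmetric bilinear form G on V* such that G(♭u, ♭v) = g(u,v) for all u, v ∈ V (G extends ĝ) and the radical of G equals C, i.e., {ω ∈ V* | G(ω,τ) = 0 for all τ ∈ V*} = C. -/
/-- If `range f` and `C` are complementary, there is a linear map in the opposite direction that
is a right inverse of `f` on `range f` and vanishes on `C`. -/
theorem LinearMap.exists_section_of_isCompl_range
    {K V W : Type*} [Field K] [AddCommGroup V] [Module K V] [AddCommGroup W] [Module K W]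
    (f : V →ₗ[K] W) {C : Submodule K W} (h : IsCompl (LinearMap.range f) C) :
    ∃ S : W →ₗ[K] V, (∀ v, f (S (f v)) = f v) ∧ ∀ w ∈ C, S w = 0 := by
  obtain ⟨s, hs⟩ := f.rangeRestrict.exists_rightInverse_of_surjective f.range_rangeRestrict
  refine ⟨s ∘ₗ Submodule.projectionOnto _ _ h, fun v => ?_, fun w hw => ?_⟩
  · have hv : Submodule.projectionOnto _ _ h (f v) = f.rangeRestrict v :=
      Submodule.projectionOnto_apply_left h (f.rangeRestrict v)
    have hsv := congrArg Subtype.val (LinearMap.congr_fun hs (f.rangeRestrict v))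
    simpa [hv] using hsv
  · rw [LinearMap.comp_apply, (Submodule.projectionOnto_apply_eq_zero_iff h).2 hw, map_zero]

/-- Extensions of the radical-annihilator inner product: if `V* = annih V ⊕ C`
(`annih V = range ♭` with `♭ = g : V → V*`), then there is a unique symmetric bilinear
form `G` on `V*` extending `ĝ` (i.e. `G(♭u,♭v) = g(u,v)`) whose radical
`{ω | G(ω,τ) = 0 ∀ τ} = ker G` equals `C`. -/
theorem cometric_extension_exists_unique
    {V : Type*} [AddCommGroup V] [Module ℝ V] [FiniteDimensional ℝ V]
    (g : V →ₗ[ℝ] V →ₗ[ℝ] ℝ) (hsymm : ∀ u v : V, g u v = g v u)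
    (C : Submodule ℝ (Module.Dual ℝ V))
    (hdisj : LinearMap.range g ⊓ C = ⊥)
    (hsum : LinearMap.range g ⊔ C = ⊤) :
    ∃! G : Module.Dual ℝ V →ₗ[ℝ] Module.Dual ℝ V →ₗ[ℝ] ℝ,
      (∀ ω τ : Module.Dual ℝ V, G ω τ = G τ ω) ∧
      (∀ u v : V, G (g u) (g v) = g u v) ∧
      LinearMap.ker G = C := by
  have decomp : ∀ ω : Module.Dual ℝ V, ∃ u, ∃ c ∈ C, g u + c = ω := fun ω => by
    obtain ⟨_, ⟨u, rfl⟩, c, hc, h⟩ := Submodule.mem_sup.1 (hsum ▸ Submodule.mem_top : ω ∈ _)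
    exact ⟨u, c, hc, h⟩
  obtain ⟨S, hS, hSC⟩ := g.exists_section_of_isCompl_range
    ⟨disjoint_iff.2 hdisj, codisjoint_iff.2 hsum⟩
  have hext : ∀ u v : V, g (S (g u)) (S (g v)) = g u v := fun u v => by
    rw [hS, hsymm, hS, hsymm]
  refine ⟨g.compl₁₂ S S, ⟨fun ω τ => hsymm _ _, hext, ?_⟩, ?_⟩
  · ext ω
    refine ⟨fun hω => ?_, fun hω => ?_⟩
    · obtain ⟨u, c, hc, rfl⟩ := decomp ω
      have hu : g u = 0 := by
        ext v
        have h := LinearMap.congr_fun (LinearMap.mem_ker.1 hω) (g v)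
        simpa [hSC c hc, hext] using h
      simpa [hu] using hc
    · ext τ
      simp [hSC ω hω]
  · rintro G ⟨hGsymm, hGext, hGker⟩
    have hC : ∀ c ∈ C, G c = 0 := fun c hc => LinearMap.mem_ker.1 (hGker ▸ hc)
    have hC' : ∀ ω, ∀ c ∈ C, G ω c = 0 := fun ω c hc => by
      rw [hGsymm, hC c hc, LinearMap.zero_apply]
    refine LinearMap.ext₂ fun ω τ => ?_
    obtain ⟨u, c, hc, rfl⟩ := decomp ω
    obtain ⟨v, d, hd, rfl⟩ := decomp τ
    simp [hC c hc, hC' _ d hd, hSC c hc, hSC d hd, hGext, hext]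
end

section
/- Let C ⊆ V* be a subspace with V* = annih V ⊕ C, and let G be the unique symmetric bilinear form on V* with G(♭u,♭v) = g(u,v) for all u,v ∈ V and radical equal to C. Let ♭*_C : V* → V be the map sending ω to the unique vector v ∈ V with τ(v) = G(ω,τ) for all τ ∈ V* (using the canonical identification V ≅ V**). Then V decomposes as the internal direct sum V = range(♭*_C) ⊕ rad V. -/
/-- Let `V* = annih V ⊕ C`, let `G` be the unique symmetric bilinear form on `V*` with
`G(♭u,♭v) = g(u,v)` and radical `C`, and let `♭*_C : V* → V` be the map sending `ω` to the
unique `v` with `τ(v) = G(ω,τ)` for all `τ`.  Then `V = range ♭*_C ⊕ rad V` as an internal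
direct sum. -/
theorem range_sharp_compl_radical
    {V : Type*} [AddCommGroup V] [Module ℝ V] [FiniteDimensional ℝ V]
    (g : V →ₗ[ℝ] V →ₗ[ℝ] ℝ) (hsymm : ∀ u v : V, g u v = g v u)
    (C : Submodule ℝ (Module.Dual ℝ V))
    (hdisj : LinearMap.range g ⊓ C = ⊥)
    (hsum : LinearMap.range g ⊔ C = ⊤)
    (G : Module.Dual ℝ V →ₗ[ℝ] Module.Dual ℝ V →ₗ[ℝ] ℝ)
    (hGsymm : ∀ ω τ : Module.Dual ℝ V, G ω τ = G τ ω)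
    (hGext : ∀ u v : V, G (g u) (g v) = g u v)
    (hGrad : LinearMap.ker G = C)
    (f : Module.Dual ℝ V →ₗ[ℝ] V)
    (hf : ∀ ω τ : Module.Dual ℝ V, τ (f ω) = G ω τ) :
    LinearMap.range f ⊓ LinearMap.ker g = ⊥ ∧
    LinearMap.range f ⊔ LinearMap.ker g = ⊤ := by
  have hgfg : ∀ u : V, g (f (g u)) = g u := fun u => by
    ext v
    rw [hsymm, hf, hGext]
  have hfC : ∀ c ∈ C, f c = 0 := fun c hc => by
    rw [← hGrad, LinearMap.mem_ker] at hc
    rw [← Module.forall_dual_apply_eq_zero_iff ℝ]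
    intro τ
    rw [hf, hc, LinearMap.zero_apply]
  constructor
  · rw [eq_bot_iff]
    rintro _ ⟨⟨ω, rfl⟩, hω⟩
    obtain ⟨_, ⟨u, rfl⟩, c, hc, rfl⟩ :=
      Submodule.mem_sup.mp (hsum ▸ Submodule.mem_top : ω ∈ LinearMap.range g ⊔ C)
    have hu : g u = 0 := by
      simpa [hfC c hc, hgfg] using hω
    simp [hfC c hc, hu]
  · rw [eq_top_iff]
    intro v _
    refine Submodule.mem_sup.mpr ⟨f (g v), ⟨g v, rfl⟩, v - f (g v), ?_, by simp⟩
    rw [LinearMap.mem_ker, map_sub, hgfg, sub_self]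
end

section
/- Let C ⊆ V* be a subspace with V* = annih V ⊕ C, and let G be the unique symmetric bilinear form on V* with G(♭u,♭v) = g(u,v) for all u,v ∈ V and radical equal to C. Let ♭*_C : V* → V send ω to the unique v ∈ V with τ(v) = G(ω,τ) for all τ ∈ V*. Then ♭ ∘ ♭*_C restricted to annih V is the identity: for every ω ∈ annih V, ♭(♭*_C(ω)) = ω. -/
/-- With `V* = annih V ⊕ C`, `G` the unique symmetric extension of `ĝ` with radical `C`,
and `♭*_C : V* → V` the induced map (`τ(♭*_C ω) = G(ω,τ)` for all `τ`), the composite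
`♭ ∘ ♭*_C` restricted to `annih V = range ♭` is the identity. -/
theorem flat_comp_sharp_eq_id_on_annihilator
    {V : Type*} [AddCommGroup V] [Module ℝ V] [FiniteDimensional ℝ V]
    (g : V →ₗ[ℝ] V →ₗ[ℝ] ℝ) (hsymm : ∀ u v : V, g u v = g v u)
    (C : Submodule ℝ (Module.Dual ℝ V))
    (hdisj : LinearMap.range g ⊓ C = ⊥)
    (hsum : LinearMap.range g ⊔ C = ⊤)
    (G : Module.Dual ℝ V →ₗ[ℝ] Module.Dual ℝ V →ₗ[ℝ] ℝ)
    (hGsymm : ∀ ω τ : Module.Dual ℝ V, G ω τ = G τ ω)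
    (hGext : ∀ u v : V, G (g u) (g v) = g u v)
    (hGrad : LinearMap.ker G = C)
    (f : Module.Dual ℝ V →ₗ[ℝ] V)
    (hf : ∀ ω τ : Module.Dual ℝ V, τ (f ω) = G ω τ) :
    ∀ ω ∈ LinearMap.range g, g (f ω) = ω := by
  rintro _ ⟨w, rfl⟩
  ext v
  rw [hsymm, hf, hGext]
end
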